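/- Let ε > 0 and let k ≥ 4 be an integer. Let D be a digraph without loops or parallel arcs with |V(D)| ≥ 48/ε³, χ(D) ≥ 16·c*_{k−1}/ε² and minimum out-degree at least ε·|V(D)|, and let C be an orientation of the k-cycle consisting of exactly two blocks, each of length at least 2. Then D contains a subdigraph isomorphic to C. -/

import Mathlib

/-- A digraph `D` (given by its arc relation `E`) contains the digraph given by the
arc relation `F` as a subdigraph: there is an injective map of the vertices preserving arcs. -/
def ContainsDigraph {V W : Type*} (E : V → V → Prop) (F : W → W → Prop) : Prop :=
  ∃ f : W → V, Function.Injective f ∧ ∀ u v : W, F u v → E (f u) (f v)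

/-- The orientation of the `k`-cycle determined by `o : ZMod k → Bool`:
the edge `i` of the cycle joins `i` and `i + 1`, and is oriented `i → i + 1`
when `o i = true`, and `i + 1 → i` when `o i = false`. -/
def cycleOrient {k : ℕ} (o : ZMod k → Bool) : ZMod k → ZMod k → Prop :=
  fun u v => (o u = true ∧ v = u + 1) ∨ (o v = false ∧ u = v + 1)

/-- The arc obtained by orienting the edge `i` of the `k`-cycle according to `o`.
Injectivity of `cycleArc o` says that distinct edges yield distinct arcs, i.e. the
orientation is a genuine digraph without parallel arcs (this is automatic for `k ≥ 3`). -/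
def cycleArc {k : ℕ} (o : ZMod k → Bool) (i : ZMod k) : ZMod k × ZMod k :=
  if o i then (i, i + 1) else (i + 1, i)

open Classical in
/-- The number of blocks of the orientation of the `k`-cycle given by `o`:
a directed cycle has a single block, and otherwise the blocks (maximal directed
subpaths) correspond bijectively to the indices `i` at which the orientation
changes between the consecutive edges `i` and `i + 1`. -/
noncomputable def blockCount {k : ℕ} (o : ZMod k → Bool) : ℕ :=
  if ∀ i, o i = o 0 then 1 else {i : ZMod k | o i ≠ o (i + 1)}.ncard

/-- The orientation of the `k`-cycle given by `o` has a block of length one, i.e.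
some edge `i + 1` is a maximal directed subpath on its own. -/
def hasShortBlock {k : ℕ} (o : ZMod k → Bool) : Prop :=
  ∃ i : ZMod k, o i ≠ o (i + 1) ∧ o (i + 1) ≠ o (i + 2)

/-- `T` is an orientation of a tree: a loopless relation, with at most one arc between
any two vertices, whose underlying undirected graph is a tree. -/
def IsTreeOrientation {W : Type*} (T : W → W → Prop) : Prop :=
  (∀ v, ¬ T v v) ∧ (∀ u v, T u v → ¬ T v u) ∧ (SimpleGraph.fromRel T).IsTree

/-- The chromatic number of (the underlying undirected graph of) the digraph given
by the arc relation `E`. -/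
noncomputable def dchrom {V : Type*} (E : V → V → Prop) : ℕ :=
  (SimpleGraph.fromRel E).chromaticNumber.toNat

/-- Burr's constant `c*_j`: the least positive integer `c` such that every digraph
(without loops or parallel arcs) with chromatic number at least `c` contains every
orientation of a tree on `j` vertices as a subdigraph. -/
noncomputable def cstar (j : ℕ) : ℕ :=
  sInf {c : ℕ | 0 < c ∧
    ∀ (n : ℕ) (E : Fin n → Fin n → Prop), (∀ v, ¬ E v v) →
      (c : ℕ∞) ≤ (SimpleGraph.fromRel E).chromaticNumber →
      ∀ T : Fin j → Fin j → Prop, IsTreeOrientation T → ContainsDigraph E T}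


/-- `S` is properly coloured by `r` colours. -/
def ColOn {V : Type} (E : V → V → Prop) (S : Set V) (r : ℕ) : Prop :=
  ∃ f : V → ℕ, (∀ v ∈ S, f v < r) ∧ ∀ u ∈ S, ∀ v ∈ S, E u v → f u ≠ f v

lemma ColOn.mono {V : Type} {E : V → V → Prop} {S S' : Set V} {r r' : ℕ}
    (h : ColOn E S r) (hS : S' ⊆ S) (hr : r ≤ r') : ColOn E S' r' := by
  obtain ⟨f, h1, h2⟩ := h
  exact ⟨f, fun v hv => (h1 v (hS hv)).trans_le hr, fun u hu v hv => h2 u (hS hu) v (hS hv)⟩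

lemma ColOn.union {V : Type} {E : V → V → Prop} {S S' : Set V} {r r' : ℕ}
    (h : ColOn E S r) (h' : ColOn E S' r') : ColOn E (S ∪ S') (r + r') := by
  classical
  obtain ⟨f, h1, h2⟩ := h
  obtain ⟨g, h3, h4⟩ := h'
  refine ⟨fun v => if v ∈ S then f v else r + g v, ?_, ?_⟩
  · intro v hv
    by_cases hvS : v ∈ S
    · simp only [hvS, if_true]; have := h1 v hvS; omega
    · simp only [hvS, if_false]
      have := h3 v (hv.resolve_left hvS); omega
  · intro u hu v hv huv
    by_cases huS : u ∈ S <;> by_cases hvS : v ∈ S <;> simp only [huS, hvS, if_true, if_false]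
    · exact h2 u huS v hvS huv
    · have := h1 u huS; omega
    · have := h1 v hvS; omega
    · have := h4 u (hu.resolve_left huS) v (hv.resolve_left hvS) huv; omega

lemma ColOn.flip {V : Type} {E : V → V → Prop} {S : Set V} {r : ℕ}
    (h : ColOn E S r) : ColOn (fun u v => E v u) S r := by
  obtain ⟨f, h1, h2⟩ := h
  exact ⟨f, h1, fun u hu v hv e => (h2 v hv u hu e).symm⟩

lemma ColOn.colorable {V : Type} {E : V → V → Prop} {r : ℕ}
    (h : ColOn E Set.univ r) : (SimpleGraph.fromRel E).Colorable r := by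
  obtain ⟨f, h1, h2⟩ := h
  refine ⟨SimpleGraph.Coloring.mk (fun v => ⟨f v, h1 v trivial⟩) ?_⟩
  intro u v huv
  rw [SimpleGraph.fromRel_adj] at huv
  intro he
  have he' : f u = f v := congrArg Fin.val he
  rcases huv.2 with h | h
  · exact h2 u trivial v trivial h he'
  · exact h2 v trivial u trivial h he'.symm

lemma colOn_of_colorable {V : Type} {E : V → V → Prop} (hl : ∀ v, ¬ E v v) {S : Set V} {r : ℕ}
    (h : (SimpleGraph.fromRel (fun u v => E u v ∧ u ∈ S ∧ v ∈ S)).Colorable r) :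
    ColOn E S r := by
  obtain ⟨f⟩ := h
  refine ⟨fun v => (f v).val, fun v _ => (f v).2, ?_⟩
  intro u hu v hv huv he
  refine f.valid (v := u) (w := v) ?_ (Fin.ext he)
  rw [SimpleGraph.fromRel_adj]
  exact ⟨fun h => hl u (by rw [← h] at huv; exact huv), Or.inl ⟨huv, hu, hv⟩⟩

open Classical in
lemma colOn_of_outdeg {V : Type} [Fintype V] (E : V → V → Prop) (r : ℕ) :
    ∀ (m : ℕ) (S : Finset V), S.card = m → (∀ v, ¬ E v v) →
      (∀ v ∈ S, (S.filter (fun u => E v u)).card ≤ r) → ColOn E (S : Set V) (2 * r + 1) := by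
  intro m
  induction m with
  | zero =>
    intro S hS _ _
    rw [Finset.card_eq_zero] at hS
    subst hS
    exact ⟨fun _ => 0, by simp, by simp⟩
  | succ m ih =>
    intro S hS hl hd
    have hne : S.Nonempty := by rw [← Finset.card_pos]; omega
    have hsum := Finset.sum_card_bipartiteAbove_eq_sum_card_bipartiteBelow (s := S) (t := S) E
    have hex : ∃ v ∈ S, (S.filter (fun u => E u v)).card ≤ r := by
      by_contra hcon
      push Not at hcon
      have h1 : ∑ v ∈ S, (S.bipartiteAbove E v).card ≤ ∑ v ∈ S, r :=
        Finset.sum_le_sum (fun v hv => hd v hv)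
      have h2 : ∑ v ∈ S, r < ∑ v ∈ S, (S.bipartiteBelow E v).card :=
        Finset.sum_lt_sum_of_nonempty hne (fun v hv => hcon v hv)
      omega
    obtain ⟨v, hv, hin⟩ := hex
    have hout := hd v hv
    obtain ⟨f, hf1, hf2⟩ := ih (S.erase v) (by rw [Finset.card_erase_of_mem hv]; omega) hl
      (fun w hw => (Finset.card_le_card
        (Finset.filter_subset_filter _ (Finset.erase_subset v S))).trans
          (hd w (Finset.mem_of_mem_erase hw)))
    obtain ⟨c, hc, hc'⟩ : ∃ c ∈ Finset.range (2 * r + 1),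
        c ∉ (S.filter (fun u => E u v) ∪ S.filter (fun u => E v u)).image f := by
      apply Finset.exists_mem_notMem_of_card_lt_card
      calc _ ≤ _ := Finset.card_image_le
        _ ≤ _ := Finset.card_union_le _ _
        _ < _ := by rw [Finset.card_range]; omega
    refine ⟨fun u => if u = v then c else f u, ?_, ?_⟩
    · intro u hu
      by_cases h : u = v
      · simpa [h] using hc
      · simp only [h, if_false]
        exact hf1 u (by simpa [h] using hu)
    · intro a ha b hb hab
      have ha' : a ∈ S := ha
      have hb' : b ∈ S := hb
      by_cases h1 : a = v <;> by_cases h2 : b = v <;> simp only [h1, h2, if_true, if_false]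
      · subst h1; subst h2; exact (hl _ hab).elim
      · intro he
        apply hc'
        subst h1
        simp only [Finset.mem_image, Finset.mem_union, Finset.mem_filter]
        exact ⟨b, Or.inr ⟨hb', hab⟩, he.symm⟩
      · intro he
        apply hc'
        subst h2
        simp only [Finset.mem_image, Finset.mem_union, Finset.mem_filter]
        exact ⟨a, Or.inl ⟨ha', hab⟩, he⟩
      · exact hf2 a (by simpa [h1] using ha) b (by simpa [h2] using hb) hab

open Classical in
/-- Either the vertices of large out-degree in `S` carry many colours ... -/
lemma large_outdeg {V : Type} [Fintype V] (E : V → V → Prop) (hl : ∀ v, ¬ E v v) (S : Finset V)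
    (c r : ℕ) (h : ¬ ColOn E (S : Set V) (c + (2 * r + 1))) :
    ¬ ColOn E ((S.filter (fun v => r < (S.filter (fun u => E v u)).card) : Finset V) : Set V) c := by
  intro h1
  have h2 := colOn_of_outdeg E r _
    (S.filter (fun v => ¬ r < (S.filter (fun u => E v u)).card)) rfl hl (by
      intro v hv
      rw [Finset.mem_filter, not_lt] at hv
      exact (Finset.card_le_card (Finset.filter_subset_filter _ (Finset.filter_subset _ S))).trans
        hv.2)
  apply h
  refine (h1.union h2).mono ?_ le_rfl
  rw [← Finset.coe_union, Finset.filter_union_filter_not_eq]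

open Classical in
lemma burr (j : ℕ) : ∃ c : ℕ, 0 < c ∧ ∀ (V : Type) [Fintype V] (E : V → V → Prop),
    (∀ v, ¬ E v v) → ∀ S : Finset V, ¬ ColOn E (S : Set V) c →
    ∀ (W : Type) [Fintype W] (T : W → W → Prop), Fintype.card W = j + 1 → IsTreeOrientation T →
    ∃ f : W → V, Function.Injective f ∧ (∀ w, f w ∈ S) ∧ ∀ u v, T u v → E (f u) (f v) := by
  induction j with
  | zero =>
    refine ⟨1, one_pos, ?_⟩
    intro V _ E hl S hS W _ T hW hT
    have hne : S.Nonempty := by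
      by_contra hne
      rw [Finset.not_nonempty_iff_eq_empty] at hne
      subst hne
      exact hS ⟨fun _ => 0, by simp, by simp⟩
    obtain ⟨x, hx⟩ := hne
    have hsub : Subsingleton W := by
      rw [← Fintype.card_le_one_iff_subsingleton]; omega
    exact ⟨fun _ => x, fun a b _ => Subsingleton.elim a b, fun _ => hx,
      fun u v huv => (hT.1 u (by rwa [Subsingleton.elim v u] at huv)).elim⟩
  | succ j ih =>
    obtain ⟨c, hc, ih⟩ := ih
    refine ⟨c + (2 * (j + 1) + 1), by omega, ?_⟩
    intro V _ E hl S hS W _ T hW hT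
    obtain ⟨hT1, hT2, hT3⟩ := hT
    have hnt : Nontrivial W := by
      rw [← Fintype.one_lt_card_iff_nontrivial]; omega
    obtain ⟨v, hv⟩ := hT3.exists_vert_degree_one_of_nontrivial
    have hconn := hT3.connected.induce_compl_singleton_of_degree_eq_one hv
    have hac := hT3.isAcyclic.induce ({v}ᶜ : Set W)
    rw [SimpleGraph.degree_eq_one_iff_existsUnique_adj] at hv
    obtain ⟨p, hp, hpu⟩ := hv
    let T' : ({v}ᶜ : Set W) → ({v}ᶜ : Set W) → Prop := fun a b => T a b
    have hT' : IsTreeOrientation T' := by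
      refine ⟨fun a => hT1 a, fun a b => hT2 a b, ?_⟩
      have : SimpleGraph.fromRel T' = (SimpleGraph.fromRel T).induce ({v}ᶜ : Set W) := by
        ext a b
        simp [T', SimpleGraph.fromRel_adj, Subtype.ext_iff]
      rw [this]
      exact ⟨hconn, hac⟩
    have hcard : Fintype.card ({v}ᶜ : Set W) = j + 1 := by
      rw [Fintype.card_compl_set]
      simp [hW]
    have hpv : p ≠ v := fun h => by
      rw [h] at hp; exact (SimpleGraph.irrefl _ hp)
    rw [SimpleGraph.fromRel_adj] at hp
    -- the extension step
    have ext : ∀ (x : V) (f : ({v}ᶜ : Set W) → V), Function.Injective f → (∀ w, f w ∈ S) →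
        (∀ a b, T' a b → E (f a) (f b)) → x ∈ S → (∀ w, f w ≠ x) →
        (T v p → E x (f ⟨p, hpv⟩)) → (T p v → E (f ⟨p, hpv⟩) x) →
        ∃ f : W → V, Function.Injective f ∧ (∀ w, f w ∈ S) ∧ ∀ u v, T u v → E (f u) (f v) := by
      intro x f hf1 hf2 hf3 hx hfx h1 h2
      refine ⟨fun w => if h : w = v then x else f ⟨w, h⟩, ?_, ?_, ?_⟩
      · intro a b hab
        by_cases ha : a = v <;> by_cases hb : b = v <;> simp only [ha, hb, dite_true, dite_false] at hab ⊢
        · exact (hfx _ hab.symm).elim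
        · exact (hfx _ hab).elim
        · exact congrArg Subtype.val (hf1 hab)
      · intro w
        by_cases hw : w = v <;> simp only [hw, dite_true, dite_false]
        · exact hx
        · exact hf2 _
      · intro a b hab
        by_cases ha : a = v <;> by_cases hb : b = v <;> simp only [ha, hb, dite_true, dite_false]
        · subst ha; subst hb; exact (hT1 _ hab).elim
        · have : b = p := hpu b ((SimpleGraph.fromRel_adj _ _ _).2 ⟨Ne.symm hb, Or.inl (ha ▸ hab)⟩)
          subst this; subst ha
          exact h1 hab
        · have : a = p := hpu a ((SimpleGraph.fromRel_adj _ _ _).2 ⟨Ne.symm ha, Or.inr (hb ▸ hab)⟩)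
          subst this; subst hb
          exact h2 hab
        · exact hf3 ⟨a, ha⟩ ⟨b, hb⟩ hab
    have room : ∀ (f : ({v}ᶜ : Set W) → V) (X : Finset V), j + 1 < X.card → ∃ x ∈ X, ∀ w, f w ≠ x := by
      intro f X hX
      obtain ⟨x, hx, hx'⟩ := Finset.exists_mem_notMem_of_card_lt_card
        (s := Finset.univ.image f) (t := X)
        ((Finset.card_image_le.trans_eq (by rw [Finset.card_univ, hcard])).trans_lt hX)
      exact ⟨x, hx, fun w hw => hx' (by rw [← hw]; exact Finset.mem_image_of_mem f (Finset.mem_univ w))⟩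
    rcases hp.2 with hvp | hpv'
    · have hS' := large_outdeg (fun u v => E v u) hl S c (j + 1) (fun h => hS h.flip)
      obtain ⟨f, hf1, hf2, hf3⟩ := ih V E hl _ (fun h => hS' h.flip) _ T' hcard hT'
      have hfp := hf2 ⟨p, hpv⟩
      rw [Finset.mem_filter] at hfp
      obtain ⟨x, hx, hx'⟩ := room f _ hfp.2
      rw [Finset.mem_filter] at hx
      exact ext x f hf1 (fun w => (Finset.mem_filter.1 (hf2 w)).1) hf3 hx.1 hx' (fun _ => hx.2)
        (fun h => (hT2 _ _ h hvp).elim)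
    · have hS' := large_outdeg E hl S c (j + 1) hS
      obtain ⟨f, hf1, hf2, hf3⟩ := ih V E hl _ hS' _ T' hcard hT'
      have hfp := hf2 ⟨p, hpv⟩
      rw [Finset.mem_filter] at hfp
      obtain ⟨x, hx, hx'⟩ := room f _ hfp.2
      rw [Finset.mem_filter] at hx
      exact ext x f hf1 (fun w => (Finset.mem_filter.1 (hf2 w)).1) hf3 hx.1 hx'
        (fun h => (hT2 _ _ h hpv').elim) (fun _ => hx.2)

lemma le_chrom_of_not_colorable {V : Type} {G : SimpleGraph V} {c : ℕ} (h : ¬ G.Colorable c) :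
    (c : ℕ∞) ≤ G.chromaticNumber := by
  by_contra hcon
  push Not at hcon
  exact h (SimpleGraph.chromaticNumber_le_iff_colorable.1 hcon.le)

lemma cstar_spec (j : ℕ) : 0 < cstar (j + 1) ∧
    ∀ (n : ℕ) (E : Fin n → Fin n → Prop), (∀ v, ¬ E v v) →
      (cstar (j + 1) : ℕ∞) ≤ (SimpleGraph.fromRel E).chromaticNumber →
      ∀ T : Fin (j + 1) → Fin (j + 1) → Prop, IsTreeOrientation T → ContainsDigraph E T := by
  refine Nat.sInf_mem (s := {c : ℕ | 0 < c ∧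
    ∀ (n : ℕ) (E : Fin n → Fin n → Prop), (∀ v, ¬ E v v) →
      (c : ℕ∞) ≤ (SimpleGraph.fromRel E).chromaticNumber →
      ∀ T : Fin (j + 1) → Fin (j + 1) → Prop, IsTreeOrientation T → ContainsDigraph E T}) ?_
  obtain ⟨c, hc, h⟩ := burr j
  refine ⟨c + 1, by omega, ?_⟩
  intro n E hl hchi T hT
  obtain ⟨f, hf, -, hf'⟩ := h (Fin n) E hl Finset.univ (by
    intro hcol
    rw [Finset.coe_univ] at hcol
    have h1 := hcol.colorable.chromaticNumber_le
    have h2 := hchi.trans h1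
    have : c + 1 ≤ c := by exact_mod_cast h2
    omega) (Fin (j + 1)) T (by simp) hT
  exact ⟨f, hf, hf'⟩

lemma embed_in (j : ℕ) (n : ℕ) (E : Fin n → Fin n → Prop) (hl : ∀ v, ¬ E v v) (S : Set (Fin n))
    (hS : ¬ ColOn E S (cstar (j + 2))) (T : Fin (j + 2) → Fin (j + 2) → Prop)
    (hT : IsTreeOrientation T) :
    ∃ f : Fin (j + 2) → Fin n, Function.Injective f ∧ (∀ w, f w ∈ S) ∧
      ∀ u v, T u v → E (f u) (f v) := by
  obtain ⟨f, hf, hf'⟩ := (cstar_spec (j + 1)).2 n (fun u v => E u v ∧ u ∈ S ∧ v ∈ S)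
    (fun v h => hl v h.1) (le_chrom_of_not_colorable (fun h => hS (colOn_of_colorable hl h))) T hT
  refine ⟨f, hf, ?_, fun u v h => (hf' u v h).1⟩
  intro w
  obtain ⟨x, hx⟩ := hT.2.2.connected.preconnected.exists_adj_of_nontrivial w
  rw [SimpleGraph.fromRel_adj] at hx
  rcases hx.2 with h | h
  · exact (hf' _ _ h).2.1
  · exact (hf' _ _ h).2.2

lemma path_tree (m : ℕ) (T : Fin (m + 1) → Fin (m + 1) → Prop) (b : ℕ → Bool)
    (hT : ∀ i j, T i j ↔ ((j : ℕ) = i + 1 ∧ b i = true) ∨ ((i : ℕ) = j + 1 ∧ b j = false)) :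
    IsTreeOrientation T := by
  refine ⟨?_, ?_, ?_⟩
  · intro v h; rw [hT] at h; omega
  · intro u v h1 h2
    rw [hT] at h1 h2
    rcases h1 with ⟨h1, h1'⟩ | ⟨h1, h1'⟩ <;> rcases h2 with ⟨h2, h2'⟩ | ⟨h2, h2'⟩
    · omega
    · rw [h1'] at h2'; cases h2'
    · rw [h1'] at h2'; cases h2'
    · omega
  · have hG : SimpleGraph.fromRel T = SimpleGraph.pathGraph (m + 1) := by
      ext i j
      rw [SimpleGraph.fromRel_adj, SimpleGraph.pathGraph_adj, hT, hT, ne_eq, Fin.ext_iff]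
      constructor
      · rintro ⟨-, h⟩; omega
      · intro h
        refine ⟨by omega, ?_⟩
        rcases h with h | h
        · cases hb : b i
          · exact Or.inr (Or.inr ⟨h.symm, rfl⟩)
          · exact Or.inl (Or.inl ⟨h.symm, rfl⟩)
        · cases hb : b j
          · exact Or.inl (Or.inr ⟨h.symm, rfl⟩)
          · exact Or.inr (Or.inl ⟨h.symm, rfl⟩)
    rw [hG]
    rw [SimpleGraph.isTree_iff_connected_and_card]
    have hc := SimpleGraph.pathGraph_connected m
    refine ⟨hc, le_antisymm ?_ ?_⟩
    · have hsub : (SimpleGraph.pathGraph (m + 1)).edgeSet ⊆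
          Set.range (fun i : Fin m => s(i.castSucc, i.succ)) := by
        intro e
        induction e using Sym2.ind with
        | _ x y =>
          intro h
          rw [SimpleGraph.mem_edgeSet, SimpleGraph.pathGraph_adj] at h
          rcases h with h | h
          · refine ⟨⟨x, by omega⟩, ?_⟩
            have h1 : Fin.castSucc (⟨x, by omega⟩ : Fin m) = x := Fin.ext rfl
            have h2 : Fin.succ (⟨x, by omega⟩ : Fin m) = y := Fin.ext h
            simp only [h1, h2]
          · refine ⟨⟨y, by omega⟩, ?_⟩
            have h1 : Fin.castSucc (⟨y, by omega⟩ : Fin m) = y := Fin.ext rfl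
            have h2 : Fin.succ (⟨y, by omega⟩ : Fin m) = x := Fin.ext h
            simp only [h1, h2]
            exact Sym2.eq_swap
      have h1 := Set.ncard_le_ncard hsub (Set.toFinite _)
      have h2 := Finite.card_range_le (fun i : Fin m => s(i.castSucc, i.succ))
      rw [Nat.card_fin] at h2 
      rw [Nat.card_fin, Nat.card_coe_set_eq]
      rw [Nat.card_coe_set_eq] at h2
      omega
    · exact hc.card_vert_le_card_edgeSet_add_one

lemma colOn_biUnion {V : Type} {E : V → V → Prop} (S : V → Set V) (r : ℕ) (L : Finset V)
    (h : ∀ t ∈ L, ColOn E (S t) r) : ColOn E {v | ∃ t ∈ L, v ∈ S t} (L.card * r) := by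
  classical
  induction L using Finset.induction_on with
  | empty => exact ⟨fun _ => 0, by simp, by simp⟩
  | insert a L ha ih =>
    have h1 := h a (Finset.mem_insert_self a L)
    have h2 := ih (fun t ht => h t (Finset.mem_insert_of_mem ht))
    refine (h1.union h2).mono ?_ ?_
    · rintro v ⟨t, ht, hv⟩
      rcases Finset.mem_insert.1 ht with rfl | ht
      · exact Or.inl hv
      · exact Or.inr ⟨t, ht, hv⟩
    · rw [Finset.card_insert_of_notMem ha]; apply le_of_eq; ring

open Classical in
lemma greedy (ε : ℝ) (hε : 0 < ε) (n : ℕ) (hn : 0 < n) (E : Fin n → Fin n → Prop)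
    (hdeg : ∀ v : Fin n, ε * (n : ℝ) ≤ ((Finset.univ.filter (fun u => E v u)).card : ℝ)) :
    ∃ L : Finset (Fin n), (L.card : ℝ) * (ε ^ 2 * n / 2) ≤ n ∧
      ((Finset.univ.filter (fun v => ∀ t ∈ L, ¬ E v t)).card : ℝ) < ε * n / 2 := by
  have hn' : (0 : ℝ) < n := by exact_mod_cast hn
  let P : Finset (Finset (Fin n)) := Finset.univ.filter (fun L =>
    (L.card : ℝ) * (ε ^ 2 * n / 2) ≤ ((Finset.univ.filter (fun v => ∃ t ∈ L, E v t)).card : ℝ))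
  have hP : P.Nonempty := ⟨∅, by simp [P]⟩
  obtain ⟨L, hL, hmax⟩ := P.exists_max_image Finset.card hP
  have hL' := (Finset.mem_filter.1 hL).2
  refine ⟨L, hL'.trans ?_, ?_⟩
  · have := Finset.card_le_univ (Finset.univ.filter (fun v => ∃ t ∈ L, E v t))
    rw [Fintype.card_fin] at this
    exact_mod_cast this
  · by_contra hcon
    push Not at hcon
    set Z := Finset.univ.filter (fun v => ∀ t ∈ L, ¬ E v t) with hZ
    have hsum := Finset.sum_card_bipartiteAbove_eq_sum_card_bipartiteBelow
      (s := Z) (t := Finset.univ) E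
    have hex : ∃ t, ε ^ 2 * n / 2 ≤ ((Z.filter (fun v => E v t)).card : ℝ) := by
      by_contra hno
      push Not at hno
      have h1 : (Z.card : ℝ) * (ε * n) ≤ ∑ v ∈ Z, ((Finset.univ.bipartiteAbove E v).card : ℝ) := by
        rw [← nsmul_eq_mul]
        exact Finset.card_nsmul_le_sum _ _ _ (fun v _ => hdeg v)
      have h2 : ∑ t : Fin n, ((Z.bipartiteBelow E t).card : ℝ) < ∑ t : Fin n, ε ^ 2 * n / 2 :=
        Finset.sum_lt_sum_of_nonempty ⟨⟨0, hn⟩, Finset.mem_univ _⟩ (fun t _ => hno t)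
      have h3 : ∑ v ∈ Z, ((Finset.univ.bipartiteAbove E v).card : ℝ)
          = ∑ t : Fin n, ((Z.bipartiteBelow E t).card : ℝ) := by exact_mod_cast hsum
      rw [Finset.sum_const, Finset.card_univ, Fintype.card_fin, nsmul_eq_mul] at h2
      have h4 : ε * n / 2 * (ε * n) ≤ (Z.card : ℝ) * (ε * n) :=
        mul_le_mul_of_nonneg_right hcon (by positivity)
      nlinarith
    obtain ⟨t, ht⟩ := hex
    have hpos : (0 : ℝ) < ε ^ 2 * n / 2 := by positivity
    have htL : t ∉ L := by
      intro htL
      have : Z.filter (fun v => E v t) = ∅ := by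
        ext v
        simp only [hZ, Finset.mem_filter, Finset.mem_univ, true_and, Finset.notMem_empty, iff_false]
        rintro ⟨h1, h2⟩
        exact h1 t htL h2
      rw [this] at ht
      simp at ht
      linarith
    have hins : insert t L ∈ P := by
      simp only [P, Finset.mem_filter, Finset.mem_univ, true_and]
      have hdisj : Disjoint (Finset.univ.filter (fun v => ∃ t ∈ L, E v t))
          (Z.filter (fun v => E v t)) := by
        rw [Finset.disjoint_left]
        intro v hv hv'
        simp only [hZ, Finset.mem_filter, Finset.mem_univ, true_and] at hv hv'
        obtain ⟨s, hs, hs'⟩ := hv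
        exact hv'.1 s hs hs'
      have hle : ((Finset.univ.filter (fun v => ∃ t ∈ L, E v t)).card : ℝ)
          + ((Z.filter (fun v => E v t)).card : ℝ)
          ≤ ((Finset.univ.filter (fun v => ∃ s ∈ insert t L, E v s)).card : ℝ) := by
        rw [← Nat.cast_add, ← Finset.card_union_of_disjoint hdisj]
        exact_mod_cast Finset.card_le_card (by
          intro v hv
          simp only [hZ, Finset.mem_union, Finset.mem_filter, Finset.mem_univ, true_and] at hv ⊢
          rcases hv with ⟨s, hs, hs'⟩ | hv
          · exact ⟨s, Finset.mem_insert_of_mem hs, hs'⟩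
          · exact ⟨t, Finset.mem_insert_self t L, hv.2⟩)
      rw [Finset.card_insert_of_notMem htL]
      push_cast
      linarith
    have := hmax _ hins
    rw [Finset.card_insert_of_notMem htL] at this
    omega

lemma close_cycle (j : ℕ) (o : ZMod (j + 4) → Bool) (t : ZMod (j + 4)) (V : Type)
    (E : V → V → Prop) (p : ℕ → V) (τ : V)
    (hinj : ∀ a b, a < j + 3 → b < j + 3 → p a = p b → a = b)
    (hτ : ∀ a, a < j + 3 → p a ≠ τ)
    (harc1 : ∀ i, i + 1 < j + 3 → o (t + 1 + (i : ZMod (j + 4))) = true → E (p i) (p (i + 1)))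
    (harc2 : ∀ i, i + 1 < j + 3 → o (t + 1 + (i : ZMod (j + 4))) = false → E (p (i + 1)) (p i))
    (h0 : E (p 0) τ) (h1 : E (p (j + 2)) τ) (ho : o t = false) (ho' : o (t - 1) = true) :
    ContainsDigraph E (cycleOrient o) := by
  have hk0 : ((j + 4 : ℕ) : ZMod (j + 4)) = 0 := ZMod.natCast_self _
  push_cast at hk0
  let q : ℕ → V := fun i => if i < j + 3 then p i else τ
  let F : ZMod (j + 4) → V := fun z => q (z - t - 1).val
  have hF : F = fun z => q (z - t - 1).val := rfl
  have edge : ∀ z, (o z = true → E (F z) (F (z + 1))) ∧ (o z = false → E (F (z + 1)) (F z)) := by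
    intro z
    obtain ⟨i, hi⟩ : ∃ i, i = (z - t - 1).val := ⟨_, rfl⟩
    have hlt : i < j + 4 := by rw [hi]; exact ZMod.val_lt _
    have hz : ((i : ℕ) : ZMod (j + 4)) = z - t - 1 := by rw [hi]; exact ZMod.natCast_zmod_val _
    have hz' : z = t + 1 + (i : ZMod (j + 4)) := by rw [hz]; ring
    have hz1 : (z + 1 - t - 1).val = (i + 1) % (j + 4) := by
      have : z + 1 - t - 1 = ((i + 1 : ℕ) : ZMod (j + 4)) := by push_cast; rw [hz]; ring
      rw [this, ZMod.val_natCast]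
    simp only [hF, hz1, ← hi, q]
    rcases (by omega : i + 1 < j + 3 ∨ i = j + 2 ∨ i = j + 3) with h | h | h
    · rw [Nat.mod_eq_of_lt (by omega), if_pos (by omega), if_pos h]
      rw [hz']
      exact ⟨harc1 i h, harc2 i h⟩
    · subst h
      have : z = t - 1 := by
        rw [hz']; push_cast; linear_combination hk0
      rw [Nat.mod_eq_of_lt (by omega), if_pos (by omega), if_neg (by omega), this, ho']
      exact ⟨fun _ => h1, fun h => by cases h⟩
    · subst h
      have : z = t := by
        rw [hz']; push_cast; linear_combination hk0
      have hm : (j + 3 + 1) % (j + 4) = 0 := Nat.mod_self _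
      rw [hm, if_pos (show 0 < j + 3 by omega), if_neg (show ¬ j + 3 < j + 3 by omega), this, ho]
      exact ⟨fun h => (by cases h), fun _ => h0⟩
  refine ⟨F, ?_, ?_⟩
  · intro a b hab
    have ha := ZMod.val_lt (a - t - 1)
    have hb := ZMod.val_lt (b - t - 1)
    have hv : (a - t - 1).val = (b - t - 1).val := by
      simp only [hF, q] at hab
      split_ifs at hab with h1 h2 h2
      · exact hinj _ _ h1 h2 hab
      · exact (hτ _ h1 hab).elim
      · exact (hτ _ h2 hab.symm).elim
      · omega
    have := ZMod.val_injective _ hv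
    linear_combination this
  · rintro u v (⟨h, rfl⟩ | ⟨h, rfl⟩)
    · exact (edge u).1 h
    · exact (edge v).2 h

lemma exists_sink (k : ℕ) [NeZero k] (o : ZMod k → Bool) (h : ¬ ∀ i, o i = o 0) :
    ∃ t, o t = false ∧ o (t - 1) = true := by
  by_contra hcon
  push Not at hcon
  have step : ∀ i, o i = true → o (i + 1) = true := by
    intro i hi
    by_contra h'
    exact hcon (i + 1) (by simpa using h') (by simpa using hi)
  have all : ∀ i, o i = true → ∀ m : ℕ, o (i + m) = true := by
    intro i hi m
    induction m with
    | zero => simpa using hi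
    | succ m ih =>
      have := step _ ih
      push_cast
      rw [← add_assoc]; exact this
  have all' : ∀ i, o i = true → ∀ z, o z = true := by
    intro i hi z
    have := all i hi (z - i).val
    rw [ZMod.natCast_zmod_val] at this
    simpa using this
  apply h
  intro i
  cases hi : o i <;> cases h0 : o 0
  · rfl
  · rw [all' 0 h0 i] at hi; exact hi.symm
  · rw [all' i hi 0] at h0; exact h0
  · rfl

/-- Lemma 2.5. Let `ε > 0` and `k ≥ 4`. Every digraph without loops or parallel arcs
with `|V(D)| ≥ 48/ε³`, `χ(D) ≥ 16·c*_{k-1}/ε²`, and minimum out-degree at least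
`ε·|V(D)|` contains every orientation of the `k`-cycle consisting of exactly two blocks,
each of length at least two, as a subdigraph. -/
theorem contains_cycle_with_two_long_blocks
    (ε : ℝ) (hε : 0 < ε) (k : ℕ) (hk : 4 ≤ k)
    (o : ZMod k → Bool) (hblocks : blockCount o = 2) (hlong : ¬ hasShortBlock o)
    (n : ℕ) (E : Fin n → Fin n → Prop) (hloops : ∀ v, ¬ E v v)
    (hn : 48 / ε ^ 3 ≤ (n : ℝ))
    (hchrom : 16 * (cstar (k - 1) : ℝ) / ε ^ 2 ≤ (dchrom E : ℝ))
    (hdeg : ∀ v : Fin n, ε * (n : ℝ) ≤ (Nat.card {u : Fin n // E v u} : ℝ)) :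
    ContainsDigraph E (cycleOrient o) := by
  classical
  obtain ⟨j, rfl⟩ : ∃ j, k = j + 4 := ⟨k - 4, by omega⟩
  have hnc : ¬ ∀ i, o i = o 0 := by
    intro h
    rw [blockCount, if_pos h] at hblocks
    omega
  obtain ⟨t, ht, ht'⟩ := exists_sink _ o hnc
  have hk0 : ((j + 4 : ℕ) : ZMod (j + 4)) = 0 := ZMod.natCast_self _
  push_cast at hk0
  have hb0 : o (t + 1) = false := by
    by_contra h
    apply hlong
    refine ⟨t - 1, ?_, ?_⟩
    · rw [sub_add_cancel, ht, ht']; simp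
    · rw [sub_add_cancel, show t - 1 + 2 = t + 1 by ring, ht]
      exact fun h' => h h'.symm
  have hb1 : o (t - 2) = true := by
    by_contra h
    apply hlong
    refine ⟨t - 2, ?_, ?_⟩
    · rw [show t - 2 + 1 = t - 1 by ring, ht']; exact h
    · rw [show t - 2 + 1 = t - 1 by ring, sub_add_cancel, ht, ht']; simp
  set b : ℕ → Bool := fun i => o (t + 1 + (i : ZMod (j + 4))) with hb
  let T : Fin (j + 3) → Fin (j + 3) → Prop := fun i i' =>
    ((i' : ℕ) = i + 1 ∧ b i = true) ∨ ((i : ℕ) = i' + 1 ∧ b i' = false)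
  have hT : IsTreeOrientation T := path_tree (j + 2) T b (fun _ _ => Iff.rfl)
  rw [show j + 4 - 1 = j + 3 by omega] at hchrom
  set c := cstar (j + 3) with hc
  have hcpos : 0 < c := (cstar_spec (j + 2)).1
  have hn0 : 0 < n := by
    have : (0 : ℝ) < 48 / ε ^ 3 := by positivity
    exact_mod_cast this.trans_le hn
  have hn0' : (0 : ℝ) < n := by exact_mod_cast hn0
  have hdeg' : ∀ v : Fin n, ε * (n : ℝ) ≤ ((Finset.univ.filter (fun u => E v u)).card : ℝ) := by
    intro v
    have := hdeg v
    rwa [Nat.card_eq_fintype_card, Fintype.card_subtype] at this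
  obtain ⟨L, hL1, hL2⟩ := greedy ε hε n hn0 E hdeg'
  have hLε : (L.card : ℝ) * ε ^ 2 ≤ 2 := by
    have : (L.card : ℝ) * ε ^ 2 * n ≤ 2 * n := by linarith
    exact le_of_mul_le_mul_right this hn0'
  by_contra hno
  -- `U τ`: vertices with two out-neighbours among the in-neighbours of `τ`
  let U : Fin n → Set (Fin n) := fun τ =>
    {u | 1 < (Finset.univ.filter (fun x => E u x ∧ E x τ)).card}
  have hcover : ∀ u, ∃ τ ∈ L, u ∈ U τ := by
    intro u
    by_contra hcon
    push Not at hcon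
    have hsub : Finset.univ.filter (fun x => E u x) ⊆
        Finset.univ.filter (fun v => ∀ t ∈ L, ¬ E v t) ∪
          L.biUnion (fun τ => Finset.univ.filter (fun x => E u x ∧ E x τ)) := by
      intro x hx
      simp only [Finset.mem_union, Finset.mem_filter, Finset.mem_univ, true_and,
        Finset.mem_biUnion] at hx ⊢
      by_cases h : ∃ τ ∈ L, E x τ
      · obtain ⟨τ, h1, h2⟩ := h
        exact Or.inr ⟨τ, h1, hx, h2⟩
      · push Not at h; exact Or.inl h
    have h1 := (Finset.card_le_card hsub).trans (Finset.card_union_le _ _)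
    have h2 : (L.biUnion (fun τ => Finset.univ.filter (fun x => E u x ∧ E x τ))).card
        ≤ L.card * 1 := Finset.card_biUnion_le_card_mul _ _ _ (fun τ hτ => by
          have := hcon τ hτ
          simpa [U] using this)
    have h3 : ((Finset.univ.filter (fun x => E u x)).card : ℝ) ≤
        ((Finset.univ.filter (fun v => ∀ t ∈ L, ¬ E v t)).card : ℝ) + L.card := by
      exact_mod_cast h1.trans (by omega)
    have h4 := hdeg' u
    have h5 : ε * n / 2 < L.card := by linarith
    have h6 : (48 : ℝ) ≤ n * ε ^ 3 := by rwa [div_le_iff₀ (by positivity)] at hn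
    have h7 : ε * n / 2 * ε ^ 2 < L.card * ε ^ 2 := mul_lt_mul_of_pos_right h5 (by positivity)
    nlinarith
  have hcol : ∀ τ ∈ L, ColOn E (U τ) (c + (c + 1)) := by
    intro τ _
    have hA : ColOn E {x | E x τ} c := by
      by_contra hA
      obtain ⟨f, hf1, hf2, hf3⟩ := embed_in (j + 1) n E hloops _ hA T hT
      apply hno
      refine close_cycle j o t _ E (fun i => if h : i < j + 3 then f ⟨i, h⟩ else τ) τ
        ?_ ?_ ?_ ?_ ?_ ?_ ht ht'
      · intro x y hx hy hxy
        simp only [hx, hy, dite_true] at hxy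
        simpa using hf1 hxy
      · intro x hx hxt
        simp only [hx, dite_true] at hxt
        have := hf2 ⟨x, hx⟩
        rw [hxt] at this
        exact hloops τ this
      · intro i hi hoi
        simp only [hi, show i < j + 3 by omega, dite_true]
        exact hf3 _ _ (Or.inl ⟨rfl, hoi⟩)
      · intro i hi hoi
        simp only [hi, show i < j + 3 by omega, dite_true]
        exact hf3 _ _ (Or.inr ⟨rfl, hoi⟩)
      · simp only [show 0 < j + 3 by omega, dite_true]
        exact hf2 _
      · simp only [show j + 2 < j + 3 by omega, dite_true]
        exact hf2 _
    have hB : ColOn E ({u | u ∈ U τ ∧ ¬ E u τ ∧ u ≠ τ}) c := by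
      by_contra hB
      obtain ⟨f, hf1, hf2, hf3⟩ := embed_in (j + 1) n E hloops _ hB T hT
      have hu := (hf2 ⟨1, by omega⟩).1
      have hv := (hf2 ⟨j + 1, by omega⟩).1
      obtain ⟨y, hy⟩ := Finset.card_pos.1 (lt_trans one_pos hu)
      obtain ⟨x, hx, hxy⟩ := Finset.exists_mem_ne hv y
      simp only [Finset.mem_filter, Finset.mem_univ, true_and] at hx hy
      have hfx : ∀ w, f w ≠ x := fun w h => (hf2 w).2.1 (h ▸ hx.2)
      have hfy : ∀ w, f w ≠ y := fun w h => (hf2 w).2.1 (h ▸ hy.2)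
      have hxτ : x ≠ τ := fun h => hloops τ (by have := hx.2; rwa [h] at this)
      have hyτ : y ≠ τ := fun h => hloops τ (by have := hy.2; rwa [h] at this)
      have hbfirst : b 0 = false := by simp [hb, hb0]
      have hblast : b (j + 1) = true := by
        have : t + 1 + ((j + 1 : ℕ) : ZMod (j + 4)) = t - 2 := by
          push_cast; linear_combination hk0
        simp only [hb, this, hb1]
      apply hno
      refine close_cycle j o t _ E (fun i => if i = 0 then y else if i = j + 2 then x else
        if h : i < j + 3 then f ⟨i, h⟩ else τ) τ ?_ ?_ ?_ ?_ ?_ ?_ ht ht'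
      · intro a a' ha ha' haa
        simp only [ha, ha', dite_true] at haa
        split_ifs at haa with h1 h2 h3 h4 h5 h6 h7 h8
        · omega
        · exact (hxy haa.symm).elim
        · exact (hfy _ haa.symm).elim
        · exact (hxy haa).elim
        · omega
        · exact (hfx _ haa.symm).elim
        · exact (hfy _ haa).elim
        · exact (hfx _ haa).elim
        · simpa using hf1 haa
      · intro a ha
        simp only [ha, dite_true]
        split_ifs with h1 h2
        · exact hyτ
        · exact hxτ
        · exact (hf2 _).2.2
      · intro i hi hoi
        have hi0 : i ≠ 0 := by
          rintro rfl
          have : b 0 = true := hoi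
          rw [hbfirst] at this; cases this
        simp only [hi0, show i + 1 ≠ 0 by omega, show i ≠ j + 2 by omega, hi,
          show i < j + 3 by omega, dite_true, if_false]
        split_ifs with h
        · obtain rfl : i = j + 1 := by omega
          exact hx.1
        · exact hf3 _ _ (Or.inl ⟨rfl, hoi⟩)
      · intro i hi hoi
        have hi1 : i ≠ j + 1 := by
          rintro rfl
          have : b (j + 1) = false := hoi
          rw [hblast] at this; cases this
        simp only [show i + 1 ≠ 0 by omega, show i ≠ j + 2 by omega,
          show i + 1 ≠ j + 2 by omega, hi,
          show i < j + 3 by omega, dite_true, if_false]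
        split_ifs with h
        · subst h
          exact hy.1
        · exact hf3 _ _ (Or.inr ⟨rfl, hoi⟩)
      · simpa using hy.2
      · simpa using hx.2
    have hC : ColOn E {τ} 1 := by
      refine ⟨fun _ => 0, by simp, ?_⟩
      intro u hu v hv huv
      rw [Set.mem_singleton_iff] at hu hv
      subst hu; subst hv
      exact (hloops _ huv).elim
    refine (hA.union (hB.union hC)).mono ?_ le_rfl
    intro u hu
    by_cases h1 : E u τ
    · exact Or.inl h1
    · by_cases h2 : u = τ
      · exact Or.inr (Or.inr h2)
      · exact Or.inr (Or.inl ⟨hu, h1, h2⟩)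
  have hall : ColOn E Set.univ (L.card * (c + (c + 1))) :=
    (colOn_biUnion U _ L hcol).mono (fun u _ => hcover u) le_rfl
  have hle : dchrom E ≤ L.card * (c + (c + 1)) :=
    ENat.toNat_le_of_le_natCast hall.colorable.chromaticNumber_le
  have hle' : (dchrom E : ℝ) ≤ L.card * (3 * c) := by
    have : dchrom E ≤ L.card * (3 * c) := hle.trans (Nat.mul_le_mul_left _ (by omega))
    exact_mod_cast this
  have hfin := hchrom.trans hle'
  rw [div_le_iff₀ (by positivity)] at hfin
  have hc' : (0 : ℝ) < c := by exact_mod_cast hcpos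
  nlinarith
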